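/- Let δ, b > 0, let e_δ(x) := exp(δ(√(x²+1) − 1)), and let 𝓜_b := {μ ∈ 𝒫(ℝ) : ∫ e_δ dμ ≤ b}. Let {f_j}_{j≥1} be an enumeration of a countable set of real polynomials that contains all monomials x ↦ x^k, k ≥ 1. Then there exists a sequence of positive reals {c_j}_{j≥1} with c_j ≤ 2^{−j} for all j, such that d(μ, ν) := Σ_{j=1}^∞ c_j |⟨μ − ν, f_j⟩| (where ⟨μ − ν, f⟩ := ∫ f dμ − ∫ f dν) is finite for all μ, ν ∈ 𝓜_b and defines a metric on 𝓜_b, and moreover a sequence {μ_n} ⊂ 𝓜_b converges weakly to μ ∈ 𝓜_b if and only if d(μ_n, μ) → 0. -/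

import Mathlib

open MeasureTheory Real Filter Topology

open ProbabilityTheory
open scoped NNReal ENNReal BoundedContinuousFunction

/-- The exponential weight `e_δ`. -/
noncomputable def expWeight (δ x : ℝ) : ℝ := Real.exp (δ * (Real.sqrt (x ^ 2 + 1) - 1))

/-- The set `𝓜_b` of probability measures with `∫ e_δ dμ ≤ b`. -/
def expMomentSet (δ b : ℝ) : Set (ProbabilityMeasure ℝ) :=
  {μ | ∫⁻ x, ENNReal.ofReal (expWeight δ x) ∂(μ : Measure ℝ) ≤ ENNReal.ofReal b}

lemma continuous_expWeight (δ : ℝ) : Continuous (expWeight δ) := by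
  unfold expWeight; fun_prop

lemma expWeight_pos (δ x : ℝ) : 0 < expWeight δ x := Real.exp_pos _

lemma exp_mul_abs_le_expWeight {δ : ℝ} (hδ : 0 ≤ δ) (x : ℝ) :
    Real.exp (δ * |x|) ≤ Real.exp δ * expWeight δ x := by
  rw [expWeight, ← Real.exp_add, Real.exp_le_exp]
  have h : |x| ≤ √(x ^ 2 + 1) := Real.abs_le_sqrt (by linarith)
  nlinarith

lemma exists_abs_eval_le_expWeight {δ : ℝ} (hδ : 0 < δ) (p : Polynomial ℝ) :
    ∃ K, 0 ≤ K ∧ ∀ x, |p.eval x| ≤ K * expWeight δ x := by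
  induction p using Polynomial.induction_on' with
  | add p q hp hq =>
    obtain ⟨K, hK, hp⟩ := hp
    obtain ⟨L, hL, hq⟩ := hq
    refine ⟨K + L, by positivity, fun x => ?_⟩
    rw [Polynomial.eval_add, add_mul]
    exact (abs_add_le _ _).trans (add_le_add (hp x) (hq x))
  | monomial n a =>
    refine ⟨|a| * (n.factorial / δ ^ n * Real.exp δ), by positivity, fun x => ?_⟩
    rw [Polynomial.eval_monomial, abs_mul, abs_pow, mul_assoc, mul_assoc]
    gcongr
    have h := Real.pow_div_factorial_le_exp (x := δ * |x|) (by positivity) n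
    calc |x| ^ n = n.factorial / δ ^ n * ((δ * |x|) ^ n / n.factorial) := by
          rw [mul_pow]
          field_simp
      _ ≤ n.factorial / δ ^ n * (Real.exp δ * expWeight δ x) := by
          gcongr
          exact h.trans (exp_mul_abs_le_expWeight hδ.le x)

lemma integrable_expWeight {δ b : ℝ} {μ : ProbabilityMeasure ℝ} (hμ : μ ∈ expMomentSet δ b) :
    Integrable (expWeight δ) (μ : Measure ℝ) := by
  refine ⟨(continuous_expWeight δ).aestronglyMeasurable, ?_⟩
  rw [hasFiniteIntegral_iff_ofReal (.of_forall fun x => (expWeight_pos δ x).le)]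
  exact lt_of_le_of_lt hμ ENNReal.ofReal_lt_top

lemma integral_expWeight_le {δ b : ℝ} (hb : 0 ≤ b) {μ : ProbabilityMeasure ℝ}
    (hμ : μ ∈ expMomentSet δ b) : ∫ x, expWeight δ x ∂(μ : Measure ℝ) ≤ b := by
  rw [integral_eq_lintegral_of_nonneg_ae (.of_forall fun x => (expWeight_pos δ x).le)
    (continuous_expWeight δ).aestronglyMeasurable]
  exact ENNReal.toReal_le_of_le_ofReal hb hμ

lemma integrable_eval {δ b : ℝ} (hδ : 0 < δ) {μ : ProbabilityMeasure ℝ}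
    (hμ : μ ∈ expMomentSet δ b) (p : Polynomial ℝ) :
    Integrable (fun x => p.eval x) (μ : Measure ℝ) := by
  obtain ⟨K, -, hK⟩ := exists_abs_eval_le_expWeight hδ p
  exact ((integrable_expWeight hμ).const_mul K).mono' p.continuous.aestronglyMeasurable
    (.of_forall hK)

lemma exists_integral_abs_eval_le {δ b : ℝ} (hδ : 0 < δ) (hb : 0 ≤ b) (p : Polynomial ℝ) :
    ∃ B, 0 ≤ B ∧ ∀ μ ∈ expMomentSet δ b, ∫ x, |p.eval x| ∂(μ : Measure ℝ) ≤ B := by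
  obtain ⟨K, hK0, hK⟩ := exists_abs_eval_le_expWeight hδ p
  refine ⟨K * b, by positivity, fun μ hμ => ?_⟩
  calc ∫ x, |p.eval x| ∂(μ : Measure ℝ) ≤ ∫ x, K * expWeight δ x ∂(μ : Measure ℝ) :=
        integral_mono (integrable_eval hδ hμ p).abs ((integrable_expWeight hμ).const_mul K) hK
    _ ≤ K * b := by
        rw [integral_const_mul]
        gcongr
        exact integral_expWeight_le hb hμ

/-- The closed-set form of lower semicontinuity of `μ ↦ ∫⁻ φ dμ` for continuous `φ`. -/
lemma isClosed_setOf_lintegral_le {E : Type*} [TopologicalSpace E] [MeasurableSpace E]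
    [OpensMeasurableSpace E] {φ : E → ℝ≥0} (hφ : Continuous φ) (C : ℝ≥0∞) :
    IsClosed {μ : ProbabilityMeasure E | ∫⁻ x, φ x ∂(μ : Measure E) ≤ C} := by
  let ψ (n : ℕ) : E →ᵇ ℝ≥0 := BoundedContinuousFunction.mkOfBound
    ⟨fun x => min (φ x) n, by fun_prop⟩ n fun x y => by
      rw [NNReal.dist_eq, abs_le]
      have hx : ((min (φ x) n : ℝ≥0) : ℝ) ≤ n := by exact_mod_cast min_le_right _ _
      have hy : ((min (φ y) n : ℝ≥0) : ℝ) ≤ n := by exact_mod_cast min_le_right _ _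
      have hx' := (min (φ x) n).coe_nonneg
      have hy' := (min (φ y) n).coe_nonneg
      constructor <;> simp only [ContinuousMap.coe_mk] <;> linarith
  have hψ (n : ℕ) (x : E) : ψ n x = min (φ x) n := rfl
  have hsup (x : E) : (φ x : ℝ≥0∞) = ⨆ n, (ψ n x : ℝ≥0∞) := by
    refine le_antisymm ?_ (iSup_le fun n => by simp [hψ])
    obtain ⟨n, hn⟩ := exists_nat_ge (φ x)
    exact le_iSup_of_le n (by simp [hψ, hn])
  have hset : {μ : ProbabilityMeasure E | ∫⁻ x, φ x ∂(μ : Measure E) ≤ C} =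
      ⋂ n, {μ : ProbabilityMeasure E | ∫⁻ x, ψ n x ∂(μ : Measure E) ≤ C} := by
    ext μ
    simp only [Set.mem_ofPred_eq, Set.mem_iInter, hsup]
    rw [lintegral_iSup (fun n => (ψ n).continuous.measurable.coe_nnreal_ennreal), iSup_le_iff]
    intro m n hmn x
    simp only [hψ]
    gcongr
  rw [hset]
  exact isClosed_iInter fun n => isClosed_le
    (ProbabilityMeasure.continuous_lintegral_boundedContinuousFunction (ψ n)) continuous_const

lemma isTightMeasureSet_expMomentSet {δ b : ℝ} (hδ : 0 < δ) (hb : 0 ≤ b) :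
    IsTightMeasureSet {(μ : Measure ℝ) | μ ∈ expMomentSet δ b} := by
  obtain ⟨B, hB0, hB⟩ := exists_integral_abs_eval_le hδ hb Polynomial.X
  simp only [Polynomial.eval_X] at hB
  refine isTightMeasureSet_of_tendsto_measure_norm_gt ?_
  have hlim : Tendsto (fun r : ℝ => ENNReal.ofReal (B / r)) atTop (𝓝 0) := by
    simpa using ENNReal.tendsto_ofReal (tendsto_const_nhds (x := B).div_atTop tendsto_id)
  refine tendsto_of_tendsto_of_tendsto_of_le_of_le' tendsto_const_nhds hlim
    (.of_forall fun _ => zero_le) ?_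
  filter_upwards [eventually_gt_atTop 0] with r hr
  refine iSup₂_le ?_
  rintro _ ⟨μ, hμ, rfl⟩
  have hint : Integrable (fun x : ℝ => |x|) (μ : Measure ℝ) := by
    simpa using (integrable_eval hδ hμ Polynomial.X).abs
  have hmarkov := mul_meas_ge_le_integral_of_nonneg
    (.of_forall fun x : ℝ => abs_nonneg x) hint r
  calc (μ : Measure ℝ) {x | r < ‖x‖} ≤ (μ : Measure ℝ) {x | r ≤ |x|} :=
        measure_mono fun x (hx : r < |x|) => hx.le
    _ = ENNReal.ofReal ((μ : Measure ℝ).real {x | r ≤ |x|}) := (ofReal_measureReal).symm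
    _ ≤ ENNReal.ofReal (B / r) := by
        gcongr
        rw [le_div_iff₀' hr]
        exact hmarkov.trans (hB μ hμ)

lemma isCompact_expMomentSet {δ b : ℝ} (hδ : 0 < δ) (hb : 0 ≤ b) :
    IsCompact (expMomentSet δ b) := by
  have hclosed : IsClosed (expMomentSet δ b) :=
    isClosed_setOf_lintegral_le (continuous_real_toNNReal.comp (continuous_expWeight δ)) (ENNReal.ofReal b)
  rw [← hclosed.closure_eq]
  exact isCompact_closure_of_isTightMeasureSet (isTightMeasureSet_expMomentSet hδ hb)

lemma abs_sub_truncate_le {R : ℝ} (hR : 0 < R) (y : ℝ) :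
    |y - max (-R) (min R y)| ≤ y ^ 2 / R := by
  rw [le_div_iff₀ hR]
  rcases le_total R y with h | h
  · rw [min_eq_left h, max_eq_right (by linarith), abs_of_nonneg (by linarith)]
    nlinarith
  · rw [min_eq_right h]
    rcases le_total (-R) y with h' | h'
    · rw [max_eq_right h']
      simp [sq_nonneg]
    · rw [max_eq_left h', abs_of_nonpos (by linarith)]
      nlinarith

/-- Polynomial moments are weakly continuous on `expMomentSet δ b`, by uniform integrability. -/
lemma continuousOn_integral_eval {δ b : ℝ} (hδ : 0 < δ) (hb : 0 ≤ b) (p : Polynomial ℝ) :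
    ContinuousOn (fun μ : ProbabilityMeasure ℝ => ∫ x, p.eval x ∂(μ : Measure ℝ))
      (expMomentSet δ b) := by
  obtain ⟨B, hB0, hB⟩ := exists_integral_abs_eval_le hδ hb (p ^ 2)
  refine continuousOn_of_uniform_approx_of_continuousOn fun u hu => ?_
  obtain ⟨ε, hε, hεu⟩ := Metric.mem_uniformity_dist.1 hu
  obtain ⟨R, hRε, hR⟩ : ∃ R, B / R < ε ∧ 0 < R :=
    (((tendsto_const_nhds (x := B).div_atTop tendsto_id).eventually_lt_const hε).and
      (eventually_gt_atTop 0)).exists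
  let q : ℝ →ᵇ ℝ := BoundedContinuousFunction.ofNormedAddCommGroup
    (fun x => max (-R) (min R (p.eval x))) (by fun_prop) R fun x => by
      rw [Real.norm_eq_abs, abs_le]
      exact ⟨le_max_left _ _, max_le (by linarith) (min_le_left _ _)⟩
  refine ⟨fun μ => ∫ x, q x ∂(μ : Measure ℝ),
    (ProbabilityMeasure.continuous_integral_boundedContinuousFunction q).continuousOn,
    fun μ hμ => hεu ?_⟩
  have hp := integrable_eval hδ hμ p
  have hp2 := integrable_eval hδ hμ (p ^ 2)
  have hq : Integrable q (μ : Measure ℝ) := q.integrable _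
  rw [Real.dist_eq, ← integral_sub hp hq]
  calc |∫ x, p.eval x - q x ∂(μ : Measure ℝ)| ≤ ∫ x, |p.eval x - q x| ∂(μ : Measure ℝ) :=
        abs_integral_le_integral_abs
    _ ≤ ∫ x, |(p ^ 2).eval x| / R ∂(μ : Measure ℝ) := by
        refine integral_mono (hp.sub hq).abs (hp2.abs.div_const R) fun x => ?_
        simp only [Polynomial.eval_pow, abs_of_nonneg (sq_nonneg (p.eval x))]
        exact abs_sub_truncate_le hR _
    _ ≤ B / R := by
        rw [integral_div]
        gcongr
        exact hB μ hμ
    _ < ε := hRε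

/-- Two finite measures on `ℝ` with exponential moments and the same polynomial moments agree. -/
lemma MeasureTheory.Measure.ext_of_moments_eq {μ ν : Measure ℝ} [IsFiniteMeasure μ]
    [IsFiniteMeasure ν] (hμ : 0 ∈ interior (integrableExpSet id μ))
    (hν : 0 ∈ interior (integrableExpSet id ν))
    (h : ∀ n : ℕ, ∫ x, x ^ n ∂μ = ∫ x, x ^ n ∂ν) : μ = ν := by
  have hder (n : ℕ) :
      iteratedDeriv n (complexMGF id μ) 0 = iteratedDeriv n (complexMGF id ν) 0 := by
    rw [iteratedDeriv_complexMGF (by simpa using hμ), iteratedDeriv_complexMGF (by simpa using hν)]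
    simp only [id_eq, zero_mul, Complex.exp_zero, mul_one, ← Complex.ofReal_pow]
    rw [integral_complex_ofReal, integral_complex_ofReal, h n]
  have hseries := (analyticAt_complexMGF (z := 0) (by simpa using hμ)).hasFPowerSeriesAt
  simp only [hder] at hseries
  have hseries' := (analyticAt_complexMGF (z := 0) (by simpa using hν)).hasFPowerSeriesAt
  have hnhds : complexMGF id μ =ᶠ[𝓝 0] complexMGF id ν := by
    filter_upwards [hseries.eventually_hasSum, hseries'.eventually_hasSum] with z hz hz'
    simpa using hz.unique hz'
  have heq : Set.EqOn (complexMGF id μ) (complexMGF id ν)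
      {z | z.re ∈ interior (integrableExpSet id μ) ∩ interior (integrableExpSet id ν)} := by
    refine AnalyticOnNhd.eqOn_of_preconnected_of_eventuallyEq (z₀ := 0)
      (analyticOnNhd_complexMGF.mono fun z hz => hz.1)
      (analyticOnNhd_complexMGF.mono fun z hz => hz.2) ?_ (by simpa using ⟨hμ, hν⟩) hnhds
    exact ((convex_integrableExpSet.interior.inter
      convex_integrableExpSet.interior).linear_preimage Complex.reLm).isPreconnected
  refine Measure.ext_of_charFun (funext fun t => ?_)
  rw [← complexMGF_id_mul_I, ← complexMGF_id_mul_I]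
  exact heq (by simpa using ⟨hμ, hν⟩)

lemma zero_mem_interior_integrableExpSet {δ b : ℝ} (hδ : 0 < δ) {μ : ProbabilityMeasure ℝ}
    (hμ : μ ∈ expMomentSet δ b) : 0 ∈ interior (integrableExpSet id (μ : Measure ℝ)) := by
  rw [mem_interior_iff_mem_nhds]
  filter_upwards [Metric.ball_mem_nhds (0 : ℝ) hδ] with t ht
  refine ((integrable_expWeight hμ).const_mul (Real.exp δ)).mono' (by fun_prop)
    (.of_forall fun x => ?_)
  rw [Real.norm_eq_abs, Real.abs_exp]
  refine le_trans (Real.exp_le_exp.2 ?_) (exp_mul_abs_le_expWeight hδ.le x)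
  rw [mem_ball_zero_iff, Real.norm_eq_abs] at ht
  calc t * x ≤ |t| * |x| := by rw [← abs_mul]; exact le_abs_self _
    _ ≤ δ * |x| := by gcongr

lemma eq_of_mem_expMomentSet_of_moments_eq {δ b : ℝ} (hδ : 0 < δ) {μ ν : ProbabilityMeasure ℝ}
    (hμ : μ ∈ expMomentSet δ b) (hν : ν ∈ expMomentSet δ b)
    (h : ∀ n : ℕ, 1 ≤ n → ∫ x, x ^ n ∂(μ : Measure ℝ) = ∫ x, x ^ n ∂(ν : Measure ℝ)) :
    μ = ν := by
  refine Subtype.ext (Measure.ext_of_moments_eq (μ := (μ : Measure ℝ)) (ν := (ν : Measure ℝ))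
    (zero_mem_interior_integrableExpSet hδ hμ) (zero_mem_interior_integrableExpSet hδ hν)
    fun n => ?_)
  rcases Nat.eq_zero_or_pos n with rfl | hn
  · simp
  · exact h n hn

/-- On `expMomentSet δ b`, convergence of moments implies weak convergence. -/
lemma tendsto_of_tendsto_moments {ι : Type*} {l : Filter ι} {δ b : ℝ} (hδ : 0 < δ) (hb : 0 ≤ b)
    {μs : ι → ProbabilityMeasure ℝ} (hμs : ∀ i, μs i ∈ expMomentSet δ b)
    {μ : ProbabilityMeasure ℝ} (hμ : μ ∈ expMomentSet δ b)
    (h : ∀ n : ℕ, 1 ≤ n →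
      Tendsto (fun i => ∫ x, x ^ n ∂(μs i : Measure ℝ)) l (𝓝 (∫ x, x ^ n ∂(μ : Measure ℝ)))) :
    Tendsto μs l (𝓝 μ) := by
  refine (tendsto_iff_ultrafilter _ _ _).2 fun U hU => ?_
  obtain ⟨ν, hν, hUν⟩ := (isCompact_expMomentSet hδ hb).ultrafilter_le_nhds (U.map μs)
    (le_principal_iff.2 (Eventually.of_forall (f := (U : Filter ι)) hμs))
  have hmem : Tendsto μs U (𝓝[expMomentSet δ b] ν) :=
    tendsto_nhdsWithin_iff.2 ⟨hUν, .of_forall hμs⟩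
  suffices μ = ν by rw [this]; exact hUν
  refine eq_of_mem_expMomentSet_of_moments_eq hδ hμ hν fun n hn => ?_
  have hcont := continuousOn_integral_eval hδ hb (Polynomial.X ^ n) ν hν
  simp only [Polynomial.eval_pow, Polynomial.eval_X] at hcont
  exact tendsto_nhds_unique ((h n hn).mono_left hU) (hcont.tendsto.comp hmem)

/-- Lemma 2.2 of the paper: given an enumeration `{f_j}` of a countable family of
polynomials containing all monomials, there are positive weights `c_j ≤ 2^{-(j+1)}`
(indices starting from `0`) making
`d(μ,ν) = ∑_j c_j |⟨μ - ν, f_j⟩|` a finite quantity and a metric on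
`𝓜_b = {μ : ∫ e_δ dμ ≤ b}`, which metrizes weak convergence on `𝓜_b`. -/
theorem metric_from_polynomials
    (δ b : ℝ) (hδ : 0 < δ) (hb : 0 < b)
    (f : ℕ → Polynomial ℝ)
    (hmono : ∀ k : ℕ, 1 ≤ k → ∃ j : ℕ, f j = Polynomial.X ^ k)
    (S : Set (ProbabilityMeasure ℝ))
    (hS : S = {μ : ProbabilityMeasure ℝ |
      ∫⁻ x, ENNReal.ofReal (Real.exp (δ * (Real.sqrt (x ^ 2 + 1) - 1))) ∂(μ : Measure ℝ)
        ≤ ENNReal.ofReal b}) :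
    ∃ c : ℕ → ℝ, (∀ j, 0 < c j ∧ c j ≤ (1 / 2 : ℝ) ^ (j + 1)) ∧
      ∀ d : ProbabilityMeasure ℝ → ProbabilityMeasure ℝ → ℝ,
        (d = fun (μ ν : ProbabilityMeasure ℝ) => ∑' j : ℕ,
          c j * |(∫ x, (f j).eval x ∂(μ : Measure ℝ)) -
                  (∫ x, (f j).eval x ∂(ν : Measure ℝ))|) →
        (∀ μ ∈ S, ∀ ν ∈ S, Summable (fun j : ℕ =>
          c j * |(∫ x, (f j).eval x ∂(μ : Measure ℝ)) -
                  (∫ x, (f j).eval x ∂(ν : Measure ℝ))|)) ∧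
        (∀ μ ∈ S, ∀ ν ∈ S, (d μ ν = 0 ↔ μ = ν)) ∧
        (∀ μ ∈ S, ∀ ν ∈ S, d μ ν = d ν μ) ∧
        (∀ μ ∈ S, ∀ ν ∈ S, ∀ ρ ∈ S, d μ ρ ≤ d μ ν + d ν ρ) ∧
        (∀ (μn : ℕ → ProbabilityMeasure ℝ), (∀ n, μn n ∈ S) → ∀ μ ∈ S,
          (Tendsto μn atTop (𝓝 μ) ↔ Tendsto (fun n => d (μn n) μ) atTop (𝓝 0))) := by
  obtain rfl : S = expMomentSet δ b := hS
  choose B hB0 hB using fun j => exists_integral_abs_eval_le hδ hb.le (f j)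
  set m : ℕ → ProbabilityMeasure ℝ → ℝ := fun j μ => ∫ x, (f j).eval x ∂(μ : Measure ℝ) with hm
  have hmB (j : ℕ) {μ : ProbabilityMeasure ℝ} (hμ : μ ∈ expMomentSet δ b) : |m j μ| ≤ B j :=
    abs_integral_le_integral_abs.trans (hB j μ hμ)
  set c : ℕ → ℝ := fun j => (1 / 2 : ℝ) ^ (j + 1) / (1 + B j) with hc
  have hpos (j : ℕ) : 0 < 1 + B j := by linarith [hB0 j]
  have hc0 (j : ℕ) : 0 < c j := div_pos (by positivity) (hpos j)
  have hcle (j : ℕ) : c j ≤ (1 / 2 : ℝ) ^ (j + 1) :=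
    div_le_self (by positivity) (by linarith [hB0 j])
  have hgeom : Summable fun j : ℕ => (1 / 2 : ℝ) ^ j := summable_geometric_two
  have hterm (j : ℕ) {μ ν : ProbabilityMeasure ℝ} (hμ : μ ∈ expMomentSet δ b)
      (hν : ν ∈ expMomentSet δ b) : c j * |m j μ - m j ν| ≤ (1 / 2 : ℝ) ^ j := by
    have h1 : |m j μ - m j ν| ≤ 2 * (1 + B j) := by
      linarith [abs_sub (m j μ) (m j ν), hmB j hμ, hmB j hν]
    calc c j * |m j μ - m j ν| ≤ c j * (2 * (1 + B j)) := by gcongr; exact (hc0 j).le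
      _ = (1 / 2 : ℝ) ^ j := by
        have := (hpos j).ne'
        simp only [hc]
        field_simp
        ring
  have hterm0 (j : ℕ) (μ ν : ProbabilityMeasure ℝ) : 0 ≤ c j * |m j μ - m j ν| :=
    mul_nonneg (hc0 j).le (abs_nonneg _)
  have hsum {μ ν : ProbabilityMeasure ℝ} (hμ : μ ∈ expMomentSet δ b)
      (hν : ν ∈ expMomentSet δ b) : Summable fun j => c j * |m j μ - m j ν| :=
    hgeom.of_nonneg_of_le (fun j => hterm0 j μ ν) fun j => hterm j hμ hν
  refine ⟨c, fun j => ⟨hc0 j, hcle j⟩, ?_⟩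
  rintro d rfl
  refine ⟨fun μ hμ ν hν => hsum hμ hν, fun μ hμ ν hν => ⟨fun h => ?_, ?_⟩,
    fun μ _ ν _ => ?_, fun μ hμ ν hν ρ hρ => ?_, fun μn hμn μ hμ => ⟨fun h => ?_, fun h => ?_⟩⟩
  · refine eq_of_mem_expMomentSet_of_moments_eq hδ hμ hν fun n hn => ?_
    obtain ⟨j, hj⟩ := hmono n hn
    have h' : ∑' j, c j * |m j μ - m j ν| = 0 := h
    have h0 := congrFun ((hasSum_zero_iff_of_nonneg fun j => hterm0 j μ ν).1
      (h' ▸ (hsum hμ hν).hasSum)) j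
    simpa [(hc0 j).ne', sub_eq_zero, hm, hj] using h0
  · rintro rfl
    simp
  · simp only [abs_sub_comm]
  · rw [← (hsum hμ hν).tsum_add (hsum hν hρ)]
    refine (hsum hμ hρ).tsum_le_tsum (fun j => ?_) ((hsum hμ hν).add (hsum hν hρ))
    rw [← mul_add]
    exact mul_le_mul_of_nonneg_left (abs_sub_le _ _ _) (hc0 j).le
  · have hconv (j : ℕ) : Tendsto (fun n => c j * |m j (μn n) - m j μ|) atTop (𝓝 0) := by
      have hmj : Tendsto (fun n => m j (μn n)) atTop (𝓝 (m j μ)) :=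
        (continuousOn_integral_eval hδ hb.le (f j) μ hμ).tendsto.comp
          (tendsto_nhdsWithin_iff.2 ⟨h, .of_forall hμn⟩)
      simpa using (hmj.sub_const (m j μ)).abs.const_mul (c j)
    simpa using tendsto_tsum_of_dominated_convergence hgeom hconv
      (.of_forall fun n j => by
        rw [Real.norm_of_nonneg (hterm0 j _ _)]
        exact hterm j (hμn n) hμ)
  · refine tendsto_of_tendsto_moments hδ hb.le hμn hμ fun k hk => ?_
    obtain ⟨j, hj⟩ := hmono k hk
    have hterm_lim : Tendsto (fun n => c j * |m j (μn n) - m j μ|) atTop (𝓝 0) :=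
      squeeze_zero (fun n => hterm0 j _ _)
        (fun n => (hsum (hμn n) hμ).le_tsum j fun i _ => hterm0 i _ _) h
    have habs : Tendsto (fun n => |m j (μn n) - m j μ|) atTop (𝓝 0) := by
      simpa [(hc0 j).ne'] using hterm_lim.const_mul (c j)⁻¹
    have := tendsto_sub_nhds_zero_iff.1 ((tendsto_zero_iff_abs_tendsto_zero _).2 habs)
    simpa [hm, hj] using this
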